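/- Let n ≥ 1 be a natural number, r > 0, and let x₁, x₂ ∈ ℝⁿ with d := |x₁ − x₂| ≤ 2r. Set θ = arccos(d/(2r)) ∈ [0, π/2]. Then the n-dimensional Lebesgue volume of the intersection of the two balls of radius r satisfies vol_n(B_r(x₁) ∩ B_r(x₂)) = 2r · vol_{n−1}(B_r^{n−1}(0)) · ∫₀^θ sinⁿ(t) dt, where vol_{n−1}(B_r^{n−1}(0)) is the (n−1)-dimensional Lebesgue volume of the radius-r ball in ℝ^{n−1} (interpreted as 1 when n = 1). -/

import Mathlib

open MeasureTheory Real

/-- An orthonormal basis of `ℝ^(m+1)` whose first vector points from `x` to `y`. -/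
theorem exists_orthonormalBasis_zero_smul_dist {m : ℕ} (x y : EuclideanSpace ℝ (Fin (m + 1))) :
    ∃ b : OrthonormalBasis (Fin (m + 1)) ℝ (EuclideanSpace ℝ (Fin (m + 1))),
      y - x = dist x y • b 0 := by
  obtain ⟨u, hu, hxy⟩ : ∃ u : EuclideanSpace ℝ (Fin (m + 1)),
      ‖u‖ = 1 ∧ y - x = dist x y • u := by
    by_cases h : x = y
    · exact ⟨EuclideanSpace.single 0 1, by simp, by simp [h]⟩
    · have hd : dist x y ≠ 0 := dist_ne_zero.mpr h
      refine ⟨(dist x y)⁻¹ • (y - x), ?_, ?_⟩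
      · rw [norm_smul, ← dist_eq_norm, dist_comm y x, norm_inv, Real.norm_of_nonneg dist_nonneg,
          inv_mul_cancel₀ hd]
      · rw [smul_inv_smul₀ hd]
  have ho : Orthonormal ℝ (({0} : Set (Fin (m + 1))).domRestrict fun _ => u) := by
    refine ⟨fun _ => hu, fun i j hij => (hij (Subsingleton.elim i j)).elim⟩
  obtain ⟨b, hb⟩ := ho.exists_orthonormalBasis_extension_of_card_eq (by simp)
  exact ⟨b, by rw [hb 0 rfl, hxy]⟩

/-- The map `ℝ × ℝᵐ → ℝ^(m+1)` given by coordinates in the orthonormal basis `b`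
centered at `c`. -/
noncomputable def OrthonormalBasis.affineChart {m : ℕ}
    (b : OrthonormalBasis (Fin (m + 1)) ℝ (EuclideanSpace ℝ (Fin (m + 1))))
    (c : EuclideanSpace ℝ (Fin (m + 1))) (p : ℝ × EuclideanSpace ℝ (Fin m)) :
    EuclideanSpace ℝ (Fin (m + 1)) :=
  c + b.repr.symm (WithLp.toLp 2 (Fin.cons p.1 (WithLp.ofLp p.2)))

theorem OrthonormalBasis.measurePreserving_affineChart {m : ℕ}
    (b : OrthonormalBasis (Fin (m + 1)) ℝ (EuclideanSpace ℝ (Fin (m + 1))))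
    (c : EuclideanSpace ℝ (Fin (m + 1))) :
    MeasurePreserving (b.affineChart c) := by
  have h₁ := (MeasurePreserving.id (volume : Measure ℝ)).prod
    (PiLp.volume_preserving_ofLp (Fin m))
  have h₂ := (volume_preserving_piFinSuccAbove (fun _ : Fin (m + 1) => ℝ) 0).symm
  have h₃ := PiLp.volume_preserving_toLp (Fin (m + 1))
  have h₄ := b.measurePreserving_repr_symm
  have h₅ := measurePreserving_add_left (volume : Measure (EuclideanSpace ℝ (Fin (m + 1)))) c
  have h := h₅.comp (h₄.comp (h₃.comp (h₂.comp h₁)))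
  have heq : b.affineChart c = (fun x => c + x) ∘ b.repr.symm ∘ WithLp.toLp 2 ∘
      (MeasurableEquiv.piFinSuccAbove (fun _ : Fin (m + 1) => ℝ) 0).symm ∘
      Prod.map id WithLp.ofLp := by
    funext p
    simp [affineChart, MeasurableEquiv.piFinSuccAbove, Fin.insertNthEquiv]
  rw [heq]
  exact h

theorem OrthonormalBasis.dist_sq_affineChart {m : ℕ}
    (b : OrthonormalBasis (Fin (m + 1)) ℝ (EuclideanSpace ℝ (Fin (m + 1))))
    (c : EuclideanSpace ℝ (Fin (m + 1))) (p : ℝ × EuclideanSpace ℝ (Fin m)) (s : ℝ) :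
    dist (b.affineChart c p) (c + s • b 0) ^ 2 = (p.1 - s) ^ 2 + ‖p.2‖ ^ 2 := by
  have h : b.affineChart c p - (c + s • b 0) =
      b.repr.symm (WithLp.toLp 2 (Fin.cons (p.1 - s) (WithLp.ofLp p.2))) := by
    apply b.repr.injective
    ext i
    refine Fin.cases ?_ (fun j => ?_) i <;>
      simp [affineChart]
  rw [dist_eq_norm, h, LinearIsometryEquiv.norm_map, EuclideanSpace.norm_sq_eq,
    Fin.sum_univ_succ, EuclideanSpace.norm_sq_eq]
  simp

theorem integral_sqrt_sq_sub_sq_pow (m : ℕ) {r x : ℝ} (hr : 0 < r) (hx : 0 ≤ x) (hxr : x ≤ r) :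
    ∫ s in x..r, √(r ^ 2 - s ^ 2) ^ m =
      r ^ (m + 1) * ∫ t in (0 : ℝ)..arccos (x / r), sin t ^ (m + 1) := by
  have h := intervalIntegral.integral_comp_mul_deriv (a := 0) (b := arccos (x / r))
    (f := fun t => r * cos t) (f' := fun t => r * (-sin t))
    (g := fun s => √(r ^ 2 - s ^ 2) ^ m)
    (fun t _ => (hasDerivAt_cos t).const_mul r) (by fun_prop) (by fun_prop)
  have h₁ : x / r ≤ 1 := (div_le_one hr).mpr hxr
  have h₂ : 0 ≤ x / r := by positivity
  simp only [cos_zero, mul_one, cos_arccos (by linarith) h₁, mul_div_cancel₀ x hr.ne'] at h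
  rw [intervalIntegral.integral_symm, ← h, ← intervalIntegral.integral_neg,
    ← intervalIntegral.integral_const_mul]
  refine intervalIntegral.integral_congr fun t ht => ?_
  rw [Set.uIcc_of_le (arccos_nonneg _)] at ht
  have hs : 0 ≤ sin t := sin_nonneg_of_nonneg_of_le_pi ht.1 (ht.2.trans (arccos_le_pi _))
  have : r ^ 2 - (r * cos t) ^ 2 = (r * sin t) ^ 2 := by
    linear_combination r ^ 2 * (sin_sq_add_cos_sq t).symm
  simp only [Function.comp, this, sqrt_sq (mul_nonneg hr.le hs)]
  ring

/-- Slicing a symmetric lens `{(t, y) | (|t| + e)² + ‖y‖² < r²}` orthogonally to its axis. -/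
theorem volume_real_lens (m : ℕ) {r e : ℝ} (he : 0 ≤ e) (her : e ≤ r) :
    volume.real {p : ℝ × EuclideanSpace ℝ (Fin m) | (|p.1| + e) ^ 2 + ‖p.2‖ ^ 2 < r ^ 2} =
      2 * (volume.real (Metric.ball (0 : EuclideanSpace ℝ (Fin m)) 1) *
        ∫ s in e..r, √(r ^ 2 - s ^ 2) ^ m) := by
  set S := {p : ℝ × EuclideanSpace ℝ (Fin m) | (|p.1| + e) ^ 2 + ‖p.2‖ ^ 2 < r ^ 2} with hS
  have hr : 0 ≤ r := he.trans her
  have hSm : MeasurableSet S := (isOpen_lt (by fun_prop) (by fun_prop)).measurableSet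
  have hslice (t : ℝ) : Prod.mk t ⁻¹' S = Metric.ball 0 √(r ^ 2 - (|t| + e) ^ 2) := by
    ext y
    simp only [hS, Set.mem_preimage, Set.mem_ofPred_eq, mem_ball_zero_iff,
      Real.lt_sqrt (norm_nonneg y)]
    constructor <;> intro h <;> linarith
  rw [measureReal_def, Measure.volume_eq_prod, Measure.prod_apply hSm,
    ← integral_toReal (measurable_measure_prodMk_left hSm).aemeasurable
      (Filter.Eventually.of_forall fun t => by rw [hslice]; exact measure_ball_lt_top)]
  simp_rw [hslice]
  rw [integral_comp_abs (f := fun s =>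
    (volume (Metric.ball (0 : EuclideanSpace ℝ (Fin m)) √(r ^ 2 - (s + e) ^ 2))).toReal)]
  congr 1
  rw [← intervalIntegral.integral_const_mul]
  have hsub := intervalIntegral.integral_comp_add_right (a := 0) (b := r - e)
    (fun s => volume.real (Metric.ball (0 : EuclideanSpace ℝ (Fin m)) 1) *
      √(r ^ 2 - s ^ 2) ^ m) e
  rw [zero_add, sub_add_cancel] at hsub
  rw [← hsub, intervalIntegral.integral_of_le (by linarith), integral_Ioc_eq_integral_Ioo]
  rw [setIntegral_eq_of_subset_of_forall_sdiff_eq_zero measurableSet_Ioi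
    (Set.Ioo_subset_Ioi_self : Set.Ioo 0 (r - e) ⊆ Set.Ioi 0)]
  · refine setIntegral_congr_fun measurableSet_Ioo fun s hs => ?_
    have hpos : 0 < √(r ^ 2 - (s + e) ^ 2) := by
      apply Real.sqrt_pos.mpr
      nlinarith [hs.1, hs.2]
    rw [Measure.addHaar_ball_of_pos _ _ hpos, ENNReal.toReal_mul,
      ENNReal.toReal_ofReal (by positivity), finrank_euclideanSpace_fin, mul_comm, measureReal_def]
  · rintro s ⟨hs, hs'⟩
    have hs0 : 0 < s := hs
    have : r - e ≤ s := by
      by_contra! h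
      exact hs' ⟨hs, h⟩
    rw [Real.sqrt_eq_zero_of_nonpos (by nlinarith)]
    simp

/-- Volume of the intersection of two balls of radius `r` in `ℝⁿ` whose centers are
at distance `d ≤ 2r`: with `θ = arccos (d / (2r))`,
`vol_n(B_r(x₁) ∩ B_r(x₂)) = 2r · vol_{n-1}(B_r^{n-1}(0)) · ∫₀^θ sinⁿ t dt`. -/
theorem volume_inter_two_balls (n : ℕ) (hn : 1 ≤ n) (r : ℝ) (hr : 0 < r)
    (x₁ x₂ : EuclideanSpace ℝ (Fin n)) (hd : dist x₁ x₂ ≤ 2 * r) :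
    (volume (Metric.ball x₁ r ∩ Metric.ball x₂ r)).toReal =
      2 * r * (volume (Metric.ball (0 : EuclideanSpace ℝ (Fin (n - 1))) r)).toReal *
        ∫ t in (0 : ℝ)..(Real.arccos (dist x₁ x₂ / (2 * r))), (Real.sin t) ^ n := by
  obtain ⟨m, rfl⟩ := Nat.exists_eq_add_of_le' hn
  rw [Nat.add_sub_cancel]
  obtain ⟨b, hb⟩ := exists_orthonormalBasis_zero_smul_dist x₁ x₂
  set e := dist x₁ x₂ / 2 with he
  have he0 : 0 ≤ e := by positivity
  have her : e ≤ r := by linarith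
  set c := x₁ + e • b 0 with hc
  have h₁ : x₁ = c + (-e) • b 0 := by rw [hc]; module
  have h₂ : x₂ = c + e • b 0 := by
    rw [hc, ← sub_add_cancel x₂ x₁, hb, he]
    module
  have hpre : b.affineChart c ⁻¹' (Metric.ball x₁ r ∩ Metric.ball x₂ r) =
      {p : ℝ × EuclideanSpace ℝ (Fin m) | (|p.1| + e) ^ 2 + ‖p.2‖ ^ 2 < r ^ 2} := by
    ext p
    have hp₁ := b.dist_sq_affineChart c p (-e)
    have hp₂ := b.dist_sq_affineChart c p e
    rw [← h₁] at hp₁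
    rw [← h₂] at hp₂
    simp only [Set.mem_preimage, Set.mem_inter_iff, Metric.mem_ball, Set.mem_ofPred_eq]
    rw [← sq_lt_sq₀ dist_nonneg hr.le, ← sq_lt_sq₀ (dist_nonneg (y := x₂)) hr.le, hp₁, hp₂]
    rcases abs_cases p.1 with ⟨h, h'⟩ | ⟨h, h'⟩ <;> rw [h]
    · exact ⟨fun H => by nlinarith [H.1], fun H => ⟨by nlinarith, by nlinarith⟩⟩
    · exact ⟨fun H => by nlinarith [H.2], fun H => ⟨by nlinarith, by nlinarith⟩⟩
  rw [← (b.measurePreserving_affineChart c).measure_preimage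
    (Metric.isOpen_ball.inter Metric.isOpen_ball).measurableSet.nullMeasurableSet, hpre,
    ← measureReal_def, volume_real_lens m he0 her, integral_sqrt_sq_sub_sq_pow m hr he0 her,
    Measure.addHaar_ball_of_pos _ _ hr, ENNReal.toReal_mul,
    ENNReal.toReal_ofReal (by positivity), finrank_euclideanSpace_fin, measureReal_def, he,
    div_div]
  ring
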